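/- Fix real constants m₀ > 0, ω > 0, ħ > 0, a > -1 and set λ₀ = √(m₀ω/ħ). Define for x ≠ 0: (X̃f)(x) = √m₀·λ₀^a·|x|^a·x·f(x), (P̃f)(x) = -iħ·(λ₀^a√m₀)⁻¹·(|x|^{-a}·f'(x) - (a/2)·|x|^{-a-2}·x·f(x)), (ã^±f)(x) = (1/√2)·(√(ω/ħ)·(X̃f)(x) ∓ (i/√(ħω))·(P̃f)(x)), and the Hamiltonian (Hf)(x) = (1/2)·P̃(P̃f)(x) + (ω²/2)·X̃(X̃f)(x). Then for every f : ℝ → ℂ that is three times differentiable on ℝ \ {0} and every x ≠ 0: H(ã⁺f)(x) - ã⁺(Hf)(x) = ħω·(1+a)·(ã⁺f)(x) and H(ã⁻f)(x) - ã⁻(Hf)(x) = -ħω·(1+a)·(ã⁻f)(x). -/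

import Mathlib

/-- The deformed position operator `(X̃f)(x) = √m₀·λ₀^a·|x|^a·x·f(x)`. -/
noncomputable def Xop (m₀ lam a : ℝ) (f : ℝ → ℂ) (x : ℝ) : ℂ :=
  ((Real.sqrt m₀ * lam ^ a * |x| ^ a * x : ℝ) : ℂ) * f x

/-- The deformed momentum operator
`(P̃f)(x) = -ihbar·(λ₀^a√m₀)⁻¹·(|x|^(-a)·f'(x) - (a/2)·|x|^(-a-2)·x·f(x))`. -/
noncomputable def Pop (hbar m₀ lam a : ℝ) (f : ℝ → ℂ) (x : ℝ) : ℂ :=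
  (-Complex.I) * (hbar : ℂ) * (((lam ^ a * Real.sqrt m₀ : ℝ) : ℂ))⁻¹ *
    (((|x| ^ (-a) : ℝ) : ℂ) * deriv f x
      - ((a / 2 : ℝ) : ℂ) * ((|x| ^ (-a - 2) : ℝ) : ℂ) * (x : ℂ) * f x)


/-- The creation operator `(ã⁺f)(x) = (1/√2)·(√(ω/ħ)·(X̃f)(x) - (i/√(ħω))·(P̃f)(x))`. -/
noncomputable def aPlus (hbar m₀ ω lam a : ℝ) (f : ℝ → ℂ) (x : ℝ) : ℂ :=
  ((1 / Real.sqrt 2 : ℝ) : ℂ) *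
    (((Real.sqrt (ω / hbar) : ℝ) : ℂ) * Xop m₀ lam a f x
      - Complex.I / ((Real.sqrt (hbar * ω) : ℝ) : ℂ) * Pop hbar m₀ lam a f x)

/-- The annihilation operator `(ã⁻f)(x) = (1/√2)·(√(ω/ħ)·(X̃f)(x) + (i/√(ħω))·(P̃f)(x))`. -/
noncomputable def aMinus (hbar m₀ ω lam a : ℝ) (f : ℝ → ℂ) (x : ℝ) : ℂ :=
  ((1 / Real.sqrt 2 : ℝ) : ℂ) *
    (((Real.sqrt (ω / hbar) : ℝ) : ℂ) * Xop m₀ lam a f x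
      + Complex.I / ((Real.sqrt (hbar * ω) : ℝ) : ℂ) * Pop hbar m₀ lam a f x)


/-- The Hamiltonian `(Hf)(x) = (1/2)·P̃(P̃f)(x) + (ω²/2)·X̃(X̃f)(x)`. -/
noncomputable def Hop (hbar m₀ ω lam a : ℝ) (f : ℝ → ℂ) (x : ℝ) : ℂ :=
  (1 / 2 : ℂ) * Pop hbar m₀ lam a (Pop hbar m₀ lam a f) x
    + ((ω ^ 2 / 2 : ℝ) : ℂ) * Xop m₀ lam a (Xop m₀ lam a f) x

theorem contDiffAt_ofReal_abs_rpow (p : ℝ) {y : ℝ} (hy : y ≠ 0) :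
    ContDiffAt ℝ 2 (fun z : ℝ => ((|z| ^ p : ℝ) : ℂ)) y :=
  Complex.ofRealCLM.contDiff.contDiffAt.comp y
    ((contDiffAt_abs hy).rpow_const_of_ne (abs_ne_zero.2 hy))

theorem contDiffAt_complex_ofReal (y : ℝ) : ContDiffAt ℝ 2 (fun z : ℝ => (z : ℂ)) y :=
  Complex.ofRealCLM.contDiff.contDiffAt

theorem differentiableAt_deriv_of_contDiffAt_two {u : ℝ → ℂ} {y : ℝ} (hu : ContDiffAt ℝ 2 u y) :
    DifferentiableAt ℝ (deriv u) y :=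
  ((hu.fderiv_right (m := 1) one_add_one_eq_two.le).differentiableAt one_ne_zero).clm_apply
    (differentiableAt_const 1)

theorem hasDerivAt_abs_rpow_mul_self (a : ℝ) {y : ℝ} (hy : y ≠ 0) :
    HasDerivAt (fun z : ℝ => |z| ^ a * z) ((1 + a) * |y| ^ a) y := by
  have h0 : 0 < |y| := abs_pos.2 hy
  have h := ((hasDerivAt_abs hy).rpow_const (p := a) (Or.inl h0.ne')).mul (hasDerivAt_id y)
  refine h.congr_deriv ?_
  have h1 : |y| ^ a = |y| ^ (a - 1) * |y| := by
    rw [← Real.rpow_add_one h0.ne', sub_add_cancel]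
  have h2 : (SignType.sign y : ℝ) * y = |y| := sign_mul_self y
  simp only [id, h1]
  linear_combination (a * |y| ^ (a - 1)) * h2

section Operators

variable {hbar m₀ ω lam a : ℝ} {f g : ℝ → ℂ} {x : ℝ}

/-- The coefficient of `f'` in the deformed momentum operator. -/
noncomputable def PopLead (hbar m₀ lam a : ℝ) (x : ℝ) : ℂ :=
  (-Complex.I) * (hbar : ℂ) * (((lam ^ a * Real.sqrt m₀ : ℝ) : ℂ))⁻¹ * ((|x| ^ (-a) : ℝ) : ℂ)

/-- The coefficient of `f` in the deformed momentum operator. -/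
noncomputable def PopZero (hbar m₀ lam a : ℝ) (x : ℝ) : ℂ :=
  (-Complex.I) * (hbar : ℂ) * (((lam ^ a * Real.sqrt m₀ : ℝ) : ℂ))⁻¹ *
    (-(((a / 2 : ℝ) : ℂ) * ((|x| ^ (-a - 2) : ℝ) : ℂ) * (x : ℂ)))

theorem Pop_eq (f : ℝ → ℂ) : Pop hbar m₀ lam a f =
    fun x => PopLead hbar m₀ lam a x * deriv f x + PopZero hbar m₀ lam a x * f x := by
  funext x
  simp only [Pop, PopLead, PopZero]
  ring

theorem contDiffAt_PopLead (hx : x ≠ 0) : ContDiffAt ℝ 2 (PopLead hbar m₀ lam a) x :=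
  contDiffAt_const.mul (contDiffAt_ofReal_abs_rpow _ hx)

theorem contDiffAt_PopZero (hx : x ≠ 0) : ContDiffAt ℝ 2 (PopZero hbar m₀ lam a) x :=
  contDiffAt_const.mul
    ((contDiffAt_const.mul (contDiffAt_ofReal_abs_rpow _ hx)).mul (contDiffAt_complex_ofReal x)).neg

theorem hasDerivAt_Xop_coeff (hx : x ≠ 0) :
    HasDerivAt (fun y : ℝ => ((Real.sqrt m₀ * lam ^ a * |y| ^ a * y : ℝ) : ℂ))
      ((Real.sqrt m₀ * lam ^ a * ((1 + a) * |x| ^ a) : ℝ) : ℂ) x := by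
  have h := ((hasDerivAt_abs_rpow_mul_self a hx).const_mul (Real.sqrt m₀ * lam ^ a)).ofReal_comp
  simpa only [mul_assoc] using h

theorem DifferentiableAt.Xop (hx : x ≠ 0) (hf : DifferentiableAt ℝ f x) :
    DifferentiableAt ℝ (Xop m₀ lam a f) x :=
  (hasDerivAt_Xop_coeff hx).differentiableAt.mul hf

theorem DifferentiableAt.Pop (hx : x ≠ 0) (hf : DifferentiableAt ℝ f x)
    (hf' : DifferentiableAt ℝ (deriv f) x) : DifferentiableAt ℝ (Pop hbar m₀ lam a f) x := by
  rw [Pop_eq]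
  exact (((contDiffAt_PopLead hx).differentiableAt two_ne_zero).mul hf').add
    (((contDiffAt_PopZero hx).differentiableAt two_ne_zero).mul hf)

theorem differentiableAt_deriv_Pop (hf : ∀ y : ℝ, y ≠ 0 → DifferentiableAt ℝ f y)
    (hf' : ∀ y : ℝ, y ≠ 0 → DifferentiableAt ℝ (deriv f) y) (hx : x ≠ 0)
    (hf'' : DifferentiableAt ℝ (deriv (deriv f)) x) :
    DifferentiableAt ℝ (deriv (Pop hbar m₀ lam a f)) x := by
  set u := PopLead hbar m₀ lam a
  set v := PopZero hbar m₀ lam a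
  have hu2 : ∀ y : ℝ, y ≠ 0 → ContDiffAt ℝ 2 u y := fun y hy => contDiffAt_PopLead hy
  have hv2 : ∀ y : ℝ, y ≠ 0 → ContDiffAt ℝ 2 v y := fun y hy => contDiffAt_PopZero hy
  have hu1 := fun y hy => (hu2 y hy).differentiableAt two_ne_zero
  have hv1 := fun y hy => (hv2 y hy).differentiableAt two_ne_zero
  have key : deriv (Pop hbar m₀ lam a f) =ᶠ[nhds x] fun y =>
      (deriv u y * deriv f y + u y * deriv (deriv f) y) + (deriv v y * f y + v y * deriv f y) := by
    filter_upwards [eventually_ne_nhds hx] with y hy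
    rw [Pop_eq]
    exact (((hu1 y hy).hasDerivAt.mul (hf' y hy).hasDerivAt).add
      ((hv1 y hy).hasDerivAt.mul (hf y hy).hasDerivAt)).deriv
  refine DifferentiableAt.congr_of_eventuallyEq ?_ key
  have hu' := differentiableAt_deriv_of_contDiffAt_two (hu2 x hx)
  have hv' := differentiableAt_deriv_of_contDiffAt_two (hv2 x hx)
  exact ((hu'.mul (hf' x hx)).add ((hu1 x hx).mul hf'')).add
    ((hv'.mul (hf x hx)).add ((hv1 x hx).mul (hf' x hx)))

theorem Pop_congr (hx : x ≠ 0) (h : ∀ y : ℝ, y ≠ 0 → f y = g y) :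
    Pop hbar m₀ lam a f x = Pop hbar m₀ lam a g x := by
  have h' : f =ᶠ[nhds x] g := (eventually_ne_nhds hx).mono h
  simp only [Pop, h'.deriv_eq, h x hx]

theorem Pop_linear_comb (c d : ℂ) (hf : DifferentiableAt ℝ f x) (hg : DifferentiableAt ℝ g x) :
    Pop hbar m₀ lam a (fun y => c * f y + d * g y) x =
      c * Pop hbar m₀ lam a f x + d * Pop hbar m₀ lam a g x := by
  have h : deriv (fun y => c * f y + d * g y) x = c * deriv f x + d * deriv g x :=
    ((hf.hasDerivAt.const_mul c).add (hg.hasDerivAt.const_mul d)).deriv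
  simp only [Pop, h]
  ring

theorem Xop_linear_comb (c d : ℂ) (f g : ℝ → ℂ) (x : ℝ) :
    Xop m₀ lam a (fun y => c * f y + d * g y) x =
      c * Xop m₀ lam a f x + d * Xop m₀ lam a g x := by
  simp only [Xop]
  ring

/-- The deformed canonical commutation relation `[P̃, X̃] = -iħ(1 + a)`. -/
theorem Pop_Xop (hm₀ : 0 < m₀) (hlam : 0 < lam) (hx : x ≠ 0) (hf : DifferentiableAt ℝ f x) :
    Pop hbar m₀ lam a (Xop m₀ lam a f) x =
      Xop m₀ lam a (Pop hbar m₀ lam a f) x + (-Complex.I * hbar * (1 + a)) * f x := by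
  have h := ((hasDerivAt_Xop_coeff (m₀ := m₀) (lam := lam) (a := a) hx).mul hf.hasDerivAt).deriv
  have hd : deriv (Xop m₀ lam a f) x = _ := h
  have hc : ((lam ^ a : ℝ) : ℂ) ≠ 0 :=
    Complex.ofReal_ne_zero.2 (Real.rpow_pos_of_pos hlam a).ne'
  have hs : ((Real.sqrt m₀ : ℝ) : ℂ) ≠ 0 := Complex.ofReal_ne_zero.2 (Real.sqrt_pos.2 hm₀).ne'
  have hp : ((|x| ^ a : ℝ) : ℂ) ≠ 0 :=
    Complex.ofReal_ne_zero.2 (Real.rpow_pos_of_pos (abs_pos.2 hx) a).ne'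
  have hn : ((|x| ^ (-a) : ℝ) : ℂ) = ((|x| ^ a : ℝ) : ℂ)⁻¹ := by
    rw [Real.rpow_neg (abs_nonneg x), Complex.ofReal_inv]
  simp only [Pop, hd]
  simp only [Xop, Pop, hn, Complex.ofReal_mul, Complex.ofReal_add, Complex.ofReal_one]
  field_simp
  ring

theorem Hop_commutator (hm₀ : 0 < m₀) (hlam : 0 < lam) (α γ : ℂ)
    (hf : ∀ y : ℝ, y ≠ 0 → DifferentiableAt ℝ f y)
    (hf' : ∀ y : ℝ, y ≠ 0 → DifferentiableAt ℝ (deriv f) y)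
    (hf'' : ∀ y : ℝ, y ≠ 0 → DifferentiableAt ℝ (deriv (deriv f)) y) (hx : x ≠ 0) :
    Hop hbar m₀ ω lam a
        (fun y => α * Xop m₀ lam a f y + γ * Pop hbar m₀ lam a f y) x
      - (α * Xop m₀ lam a (Hop hbar m₀ ω lam a f) x
        + γ * Pop hbar m₀ lam a (Hop hbar m₀ ω lam a f) x)
      = (-Complex.I * hbar * (1 + a)) *
        (α * Pop hbar m₀ lam a f x - γ * ω ^ 2 * Xop m₀ lam a f x) := by
  set k : ℂ := -Complex.I * hbar * (1 + a)
  set X := Xop m₀ lam a with hX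
  set P := Pop hbar m₀ lam a with hP
  have dX : ∀ {g : ℝ → ℂ}, (∀ y : ℝ, y ≠ 0 → DifferentiableAt ℝ g y) →
      ∀ y : ℝ, y ≠ 0 → DifferentiableAt ℝ (X g) y := fun hg y hy => (hg y hy).Xop hy
  have dPf : ∀ y : ℝ, y ≠ 0 → DifferentiableAt ℝ (P f) y :=
    fun y hy => (hf y hy).Pop hy (hf' y hy)
  have dPPf : ∀ y : ℝ, y ≠ 0 → DifferentiableAt ℝ (P (P f)) y := fun y hy =>
    (dPf y hy).Pop hy (differentiableAt_deriv_Pop hf hf' hy (hf'' y hy))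
  have comm : ∀ {g : ℝ → ℂ}, (∀ y : ℝ, y ≠ 0 → DifferentiableAt ℝ g y) →
      ∀ y : ℝ, y ≠ 0 → P (X g) y = X (P g) y + k * g y :=
    fun hg y hy => Pop_Xop hm₀ hlam hy (hg y hy)
  have dA : ∀ y : ℝ, y ≠ 0 → DifferentiableAt ℝ (fun z => X (P f) z + k * f z) y :=
    fun y hy => (dX dPf y hy).add ((hf y hy).const_mul k)
  have h1 : ∀ y : ℝ, y ≠ 0 → P (fun z => α * X f z + γ * P f z) y =
      α * (X (P f) y + k * f y) + γ * P (P f) y := by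
    intro y hy
    rw [← comm hf y hy]
    exact Pop_linear_comb α γ (dX hf y hy) (dPf y hy)
  have h2 : P (P (fun z => α * X f z + γ * P f z)) x =
      α * (X (P (P f)) x + 2 * k * P f x) + γ * P (P (P f)) x := by
    have e1 : P (P (fun z => α * X f z + γ * P f z)) x =
        P (fun y => α * (X (P f) y + k * f y) + γ * P (P f) y) x := Pop_congr hx h1
    have e2 : P (fun y => α * (X (P f) y + k * f y) + γ * P (P f) y) x =
        α * P (fun y => X (P f) y + k * f y) x + γ * P (P (P f)) x :=
      Pop_linear_comb α γ (dA x hx) (dPPf x hx)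
    have e3 : P (fun y => 1 * X (P f) y + k * f y) x = 1 * P (X (P f)) x + k * P f x :=
      Pop_linear_comb 1 k (dX dPf x hx) (hf x hx)
    simp only [one_mul] at e3
    rw [e1, e2, e3, comm dPf x hx]
    ring
  have h3 : P (Hop hbar m₀ ω lam a f) x =
      1 / 2 * P (P (P f)) x + ((ω ^ 2 / 2 : ℝ) : ℂ) * (X (X (P f)) x + 2 * k * X f x) := by
    have e1 : P (Hop hbar m₀ ω lam a f) x =
        1 / 2 * P (P (P f)) x + ((ω ^ 2 / 2 : ℝ) : ℂ) * P (X (X f)) x :=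
      Pop_linear_comb _ _ (dPPf x hx) (dX (dX hf) x hx)
    have e2 : X (P (X f)) x = X (X (P f)) x + k * X f x := by
      have := comm hf x hx
      simp only [hX, Xop] at this ⊢
      rw [this]
      ring
    rw [e1, comm (dX hf) x hx, e2]
    ring
  have h4 : X (Hop hbar m₀ ω lam a f) x =
      1 / 2 * X (P (P f)) x + ((ω ^ 2 / 2 : ℝ) : ℂ) * X (X (X f)) x :=
    Xop_linear_comb _ _ _ _ x
  have h5 : X (X (fun z => α * X f z + γ * P f z)) x =
      α * X (X (X f)) x + γ * X (X (P f)) x := by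
    simp only [hX, Xop]
    ring
  rw [h3, h4]
  simp only [Hop, ← hX, ← hP]
  rw [h2, h5]
  push_cast
  ring

end Operators

theorem sqrt_div_eq_div_sqrt_mul {ω hbar : ℝ} (hω : 0 < ω) (hhb : 0 < hbar) :
    Real.sqrt (ω / hbar) = ω / Real.sqrt (hbar * ω) := by
  rw [Real.sqrt_div hω.le, Real.sqrt_mul hhb.le, div_eq_div_iff (Real.sqrt_pos.2 hhb).ne'
    (mul_pos (Real.sqrt_pos.2 hhb) (Real.sqrt_pos.2 hω)).ne']
  linear_combination Real.sqrt hbar * Real.mul_self_sqrt hω.le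

/-- the commutation relations `[H, ã^±] = ±ħω(1+a)ã^±` for every `f` three times
differentiable on `ℝ \ {0}` and every `x ≠ 0`. -/
theorem stmt3 (m₀ ω hbar a : ℝ) (hm₀ : 0 < m₀) (hω : 0 < ω) (hhb : 0 < hbar) (ha : -1 < a)
    (lam : ℝ) (hlam : lam = Real.sqrt (m₀ * ω / hbar))
    (f : ℝ → ℂ)
    (hf : ∀ y : ℝ, y ≠ 0 → DifferentiableAt ℝ f y)
    (hf' : ∀ y : ℝ, y ≠ 0 → DifferentiableAt ℝ (deriv f) y)
    (hf'' : ∀ y : ℝ, y ≠ 0 → DifferentiableAt ℝ (deriv (deriv f)) y)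
    (x : ℝ) (hx : x ≠ 0) :
    Hop hbar m₀ ω lam a (aPlus hbar m₀ ω lam a f) x
        - aPlus hbar m₀ ω lam a (Hop hbar m₀ ω lam a f) x
      = ((hbar * ω * (1 + a) : ℝ) : ℂ) * aPlus hbar m₀ ω lam a f x ∧
    Hop hbar m₀ ω lam a (aMinus hbar m₀ ω lam a f) x
        - aMinus hbar m₀ ω lam a (Hop hbar m₀ ω lam a f) x
      = -((hbar * ω * (1 + a) : ℝ) : ℂ) * aMinus hbar m₀ ω lam a f x := by
  have hl : 0 < lam := hlam ▸ Real.sqrt_pos.2 (by positivity)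
  have hr : ((Real.sqrt (hbar * ω) : ℝ) : ℂ) ≠ 0 :=
    Complex.ofReal_ne_zero.2 (Real.sqrt_pos.2 (by positivity)).ne'
  have hs : ((Real.sqrt (ω / hbar) : ℝ) : ℂ) = ω / ((Real.sqrt (hbar * ω) : ℝ) : ℂ) := by
    rw [sqrt_div_eq_div_sqrt_mul hω hhb, Complex.ofReal_div]
  have hI : Complex.I ^ 2 = -1 := Complex.I_sq
  set c : ℂ := ((1 / Real.sqrt 2 : ℝ) : ℂ) with hc
  set r : ℂ := ((Real.sqrt (hbar * ω) : ℝ) : ℂ) with hr'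
  constructor
  · have hA : ∀ g : ℝ → ℂ, aPlus hbar m₀ ω lam a g = fun y =>
        (c * (ω / r)) * Xop m₀ lam a g y + (-c * (Complex.I / r)) * Pop hbar m₀ lam a g y := by
      intro g
      funext y
      simp only [aPlus, ← hc, ← hr', hs]
      ring
    simp only [hA]
    rw [Hop_commutator hm₀ hl _ _ hf hf' hf'' hx]
    push_cast
    linear_combination (-(hbar * (1 + a) * c / r * ω ^ 2 * Xop m₀ lam a f x)) * hI
  · have hA : ∀ g : ℝ → ℂ, aMinus hbar m₀ ω lam a g = fun y =>
        (c * (ω / r)) * Xop m₀ lam a g y + (c * (Complex.I / r)) * Pop hbar m₀ lam a g y := by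
      intro g
      funext y
      simp only [aMinus, ← hc, ← hr', hs]
      ring
    simp only [hA]
    rw [Hop_commutator hm₀ hl _ _ hf hf' hf'' hx]
    push_cast
    linear_combination (hbar * (1 + a) * c / r * ω ^ 2 * Xop m₀ lam a f x) * hI
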